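/- arXiv:math/0602650 — 2 statements merged into one kernel-verified Lean document; each statement's English description precedes it below -/
import Mathlib

section
/- Let p be a prime with p ≡ 1 (mod 3) (and, if n is even, assume in addition p ≡ 3 (mod 4)), let n ≥ 1, let q = p^n, let K = ℚ[X]/(X⁴ − qX² + q²), let π be the image of X in K, and let K⁺ = ℚ(π + q/π). Then there is exactly one prime ideal of the ring of integers of K⁺ lying over the rational prime p, and this prime splits in K/K⁺: there are exactly two distinct prime ideals of the ring of integers of K lying over it. -/
open Polynomial NumberField

theorem exists_add_mul_of_mem_adjoin_of_sq_eq {R A : Type*} [CommRing R] [CommRing A] [Algebra R A]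
    {y : A} {s m : R} (hy : y ^ 2 = algebraMap R A s * y - algebraMap R A m) {x : A}
    (hx : x ∈ Algebra.adjoin R {y}) :
    ∃ a b : R, x = algebraMap R A a + algebraMap R A b * y := by
  induction hx using Algebra.adjoin_induction with
  | mem x hx => exact ⟨0, 1, by simpa using hx⟩
  | algebraMap r => exact ⟨r, 0, by simp⟩
  | add x z _ _ hx hz =>
    obtain ⟨a, b, rfl⟩ := hx
    obtain ⟨c, d, rfl⟩ := hz
    exact ⟨a + c, b + d, by simp only [map_add]; ring⟩
  | mul x z _ _ hx hz =>
    obtain ⟨a, b, rfl⟩ := hx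
    obtain ⟨c, d, rfl⟩ := hz
    refine ⟨a * c - b * d * m, a * d + b * c + b * d * s, ?_⟩
    simp only [map_add, map_sub, map_mul]
    linear_combination (algebraMap R A b * algebraMap R A d) * hy

theorem exists_int_of_isIntegral_algebraMap {K : Type*} [Field K] [Algebra ℚ K] {a : ℚ}
    (ha : IsIntegral ℤ (algebraMap ℚ K a)) : ∃ k : ℤ, (k : ℚ) = a := by
  have h : IsIntegral ℤ a := (isIntegral_algebraMap_iff (algebraMap ℚ K).injective).1 ha
  simpa using IsIntegrallyClosed.isIntegral_iff.1 h

/-- An integral element of `ℚ(√d)` is a root of a monic integral quadratic polynomial whose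
discriminant is `d` times a rational square. -/
theorem exists_sq_sub_mul_add_eq_zero_of_isIntegral {K : Type*} [Field K] [Algebra ℚ K] {β : K}
    {d : ℚ} (hβ : β ^ 2 = algebraMap ℚ K d) (σ : K →ₐ[ℚ] K) (hσ : σ β = -β) {x : K}
    (hx : x ∈ IntermediateField.adjoin ℚ {β}) (hint : IsIntegral ℤ x) :
    ∃ (t N : ℤ) (c : ℚ), x ^ 2 - t * x + N = 0 ∧ (t : ℚ) ^ 2 - 4 * N = d * c ^ 2 := by
  have halg : IsAlgebraic ℚ β :=
    IsIntegral.isAlgebraic (IsIntegral.of_pow two_pos (hβ ▸ isIntegral_algebraMap))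
  rw [← IntermediateField.mem_toSubalgebra,
    IntermediateField.adjoin_simple_toSubalgebra_of_isAlgebraic halg] at hx
  obtain ⟨a, b, rfl⟩ := exists_add_mul_of_mem_adjoin_of_sq_eq (s := 0) (m := -d)
    (by simp [hβ, -eq_ratCast]) hx
  have hint' := map_isIntegral_int σ hint
  simp only [map_add, map_mul, AlgHom.commutes, hσ] at hint'
  obtain ⟨t, ht⟩ := exists_int_of_isIntegral_algebraMap (K := K) (a := 2 * a) <| by
    convert! hint.add hint' using 1
    simp only [map_mul, map_ofNat]; ring
  obtain ⟨N, hN⟩ := exists_int_of_isIntegral_algebraMap (K := K) (a := a ^ 2 - b ^ 2 * d) <| by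
    convert! hint.mul hint' using 1
    simp only [map_sub, map_mul, map_pow]
    linear_combination (algebraMap ℚ K b) ^ 2 * hβ
  refine ⟨t, N, 2 * b, ?_, by rw [ht, hN]; ring⟩
  have ht' : (t : K) = 2 * algebraMap ℚ K a := by
    rw [← map_intCast (algebraMap ℚ K), ht, map_mul, map_ofNat]
  have hN' : (N : K) = algebraMap ℚ K a ^ 2 - algebraMap ℚ K b ^ 2 * algebraMap ℚ K d := by
    rw [← map_intCast (algebraMap ℚ K), hN, map_sub, map_mul, map_pow, map_pow]
  rw [ht', hN']
  linear_combination (algebraMap ℚ K b) ^ 2 * hβ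

theorem not_isSquare_three_of_mod {p : ℕ} [Fact p.Prime] (hp3 : p % 3 = 1) (hp4 : p % 4 = 3) :
    ¬ IsSquare (3 : ZMod p) := by
  have h := ZMod.exists_sq_eq_prime_iff_of_mod_four_eq_three (p := p) (q := 3) hp4 rfl
    (by rintro rfl; omega)
  have h1 : (p : ZMod 3) = 1 := by
    rw [← Nat.cast_one, ZMod.natCast_eq_natCast_iff]; exact hp3
  rw [h1] at h
  exact_mod_cast fun h3 => h.1 h3 ⟨1, by simp⟩

theorem dvd_of_sq_sub_eq_three_mul_pow_mul_sq {p n : ℕ} (hp : p.Prime) (hp3 : p % 3 = 1)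
    (hp4 : Even n → p % 4 = 3) {t N : ℤ} {c : ℚ}
    (h : (t : ℚ) ^ 2 - 4 * N = 3 * (p : ℚ) ^ n * c ^ 2) (hN : (p : ℤ) ∣ N) : (p : ℤ) ∣ t := by
  have : Fact p.Prime := ⟨hp⟩
  have hp0 : (p : ℚ) ≠ 0 := by exact_mod_cast hp.ne_zero
  by_contra ht
  have hd : ¬ (p : ℤ) ∣ t ^ 2 - 4 * N := fun hd => ht <| by
    have := dvd_add hd (hN.mul_left 4)
    rw [sub_add_cancel] at this
    exact (Nat.prime_iff_prime_int.1 hp).dvd_of_dvd_pow this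
  have hdq : (t : ℚ) ^ 2 - 4 * N = ((t ^ 2 - 4 * N : ℤ) : ℚ) := by push_cast; ring
  have hc : c ≠ 0 := by
    rintro rfl
    rw [hdq] at h
    have h0 : t ^ 2 - 4 * N = 0 := by
      have h' : ((t ^ 2 - 4 * N : ℤ) : ℚ) = 0 := by rw [h]; simp
      exact_mod_cast h'
    exact hd (h0 ▸ dvd_zero _)
  rcases Nat.even_or_odd n with hn | hn
  · apply not_isSquare_three_of_mod hp3 (hp4 hn)
    obtain ⟨m, rfl⟩ := hn
    set e : ℚ := p ^ m * c with he
    have h2 : (t ^ 2 - 4 * N) * (e.den : ℤ) ^ 2 = 3 * e.num ^ 2 := by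
      have : ((t : ℚ) ^ 2 - 4 * N) * (e.den : ℚ) ^ 2 = 3 * (e.num : ℚ) ^ 2 := by
        rw [h, ← Rat.mul_den_eq_num e, he]; ring
      exact_mod_cast this
    have hNz : (N : ZMod p) = 0 := (ZMod.intCast_zmod_eq_zero_iff_dvd _ _).2 hN
    have htz : (t : ZMod p) ≠ 0 := fun h0 => ht ((ZMod.intCast_zmod_eq_zero_iff_dvd _ _).1 h0)
    have h3 : (3 : ZMod p) ≠ 0 := fun h0 => by
      have := (ZMod.natCast_eq_zero_iff 3 p).1 (by exact_mod_cast h0)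
      have := (Nat.prime_dvd_prime_iff_eq hp Nat.prime_three).1 this
      omega
    have h2z : (t : ZMod p) ^ 2 * (e.den : ZMod p) ^ 2 = 3 * (e.num : ZMod p) ^ 2 := by
      have := congrArg (Int.cast : ℤ → ZMod p) h2
      push_cast at this
      simpa [hNz] using this
    have hnum : (e.num : ZMod p) ≠ 0 := fun h0 => by
      have hden : (e.den : ZMod p) = 0 := by simpa [h0, htz] using h2z
      have h1 : p ∣ e.num.natAbs :=
        Int.natCast_dvd.1 ((ZMod.intCast_zmod_eq_zero_iff_dvd _ _).1 h0)
      have h2 : p ∣ e.den := (ZMod.natCast_eq_zero_iff _ _).1 hden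
      exact Nat.not_coprime_of_dvd_of_dvd hp.one_lt h1 h2 e.reduced
    refine ⟨t * e.den / e.num, ?_⟩
    field_simp
    linear_combination -h2z
  · have hv := congrArg (padicValRat p) h
    rw [hdq, padicValRat.of_int, padicValInt.eq_zero_of_not_dvd hd, padicValRat.mul
      (mul_ne_zero three_ne_zero (pow_ne_zero _ hp0)) (pow_ne_zero _ hc), padicValRat.mul
      three_ne_zero (pow_ne_zero _ hp0), padicValRat.pow, padicValRat.pow,
      padicValRat.self hp.one_lt] at hv
    have h3 : padicValRat p 3 = 0 := by
      have : padicValNat p 3 = 0 := padicValNat.eq_zero_of_not_dvd fun hd => by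
        have := (Nat.prime_dvd_prime_iff_eq hp Nat.prime_three).1 hd
        omega
      rw [show (3 : ℚ) = ((3 : ℕ) : ℚ) by norm_num, padicValRat.of_nat, this]; rfl
    rw [h3] at hv
    push_cast at hv
    obtain ⟨k, rfl⟩ := hn
    push_cast at hv
    omega

theorem exists_int_dvd_sq_sub_add_one {p : ℕ} (hp : p.Prime) (hp3 : p % 3 = 1) :
    ∃ r : ℤ, (p : ℤ) ∣ r ^ 2 - r + 1 := by
  have : Fact p.Prime := ⟨hp⟩
  obtain ⟨u, hu⟩ := exists_prime_orderOf_dvd_card (G := (ZMod p)ˣ) 3 <| by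
    rw [ZMod.card_units]
    omega
  have hu3 : (u : ZMod p) ^ 3 = 1 := by
    rw [← Units.val_pow_eq_pow_val, ← hu, pow_orderOf_eq_one, Units.val_one]
  have hu1 : (u : ZMod p) - 1 ≠ 0 := fun h => by
    have : u = 1 := Units.ext (sub_eq_zero.1 h)
    simp [this] at hu
  refine ⟨-((u : ZMod p).val : ℤ), (ZMod.intCast_zmod_eq_zero_iff_dvd _ _).1 ?_⟩
  push_cast
  rw [ZMod.natCast_val, ZMod.cast_id]
  refine mul_left_cancel₀ hu1 ?_
  linear_combination hu3

theorem Int.mem_iff_dvd_of_comap_eq_span {B : Type*} [CommRing B] {P : Ideal B} {p : ℤ}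
    (hP : P.comap (algebraMap ℤ B) = Ideal.span {p}) (k : ℤ) : (k : B) ∈ P ↔ p ∣ k := by
  rw [← Ideal.mem_span_singleton, ← hP, Ideal.mem_comap, eq_intCast]

/-- If `τ` is an involution of an integral extension `B` of `A` whose norms `x * τ x` come from `A`,
and some `u` has norm in the prime `P` but trace outside it, then exactly two primes of `B` lie
over `P`. -/
theorem ncard_primes_over_eq_two {A B : Type*} [CommRing A] [CommRing B] [Algebra A B]
    [Algebra.IsIntegral A B] [FaithfulSMul A B] (τ : B →+* B)
    (hτ : ∀ a : A, τ (algebraMap A B a) = algebraMap A B a)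
    (hnorm : ∀ b, ∃ a, algebraMap A B a = b * τ b) (P : Ideal A) [P.IsPrime] {u : B} {m s : A}
    (hm : u * τ u = algebraMap A B m) (hmP : m ∈ P) (hs : u + τ u = algebraMap A B s)
    (hsP : s ∉ P) :
    {Q : Ideal B | Q.IsPrime ∧ Q.comap (algebraMap A B) = P}.ncard = 2 := by
  obtain ⟨Q, -, hQ, hQP⟩ := Ideal.exists_ideal_over_prime_of_isIntegral (S := B) P ⊥ <| by
    rw [← RingHom.ker_eq_comap_bot,
      (RingHom.injective_iff_ker_eq_bot _).1 (FaithfulSMul.algebraMap_injective A B)]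
    exact bot_le
  have hcomap (I : Ideal B) : (I.comap τ).comap (algebraMap A B) = I.comap (algebraMap A B) := by
    ext a
    simp [hτ]
  have hne : Q ≠ Q.comap τ := fun h => by
    have key : ∀ v, v ∈ Q ↔ τ v ∈ Q := fun v => by
      conv_lhs => rw [h]
      rfl
    have huQ : u * τ u ∈ Q := by
      rw [hm, ← Ideal.mem_comap, hQP]; exact hmP
    have hu : u ∈ Q := (hQ.mem_or_mem huQ).elim id (key u).2
    apply hsP
    rw [← hQP, Ideal.mem_comap, ← hs]
    exact Q.add_mem hu ((key u).1 hu)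
  rw [Set.ncard_eq_two]
  refine ⟨Q, Q.comap τ, hne, Set.ext fun I => ⟨fun ⟨hI, hIP⟩ => ?_, ?_⟩⟩
  · have hle : (I : Set B) ⊆ Q ∪ Q.comap τ := fun x hx => by
      obtain ⟨a, ha⟩ := hnorm x
      have hxQ : x * τ x ∈ Q := by
        rw [← ha, ← Ideal.mem_comap, hQP, ← hIP, Ideal.mem_comap, ha]
        exact I.mul_mem_right _ hx
      exact hQ.mem_or_mem hxQ
    have heq {J : Ideal B} (hJ : J.comap (algebraMap A B) = P) (hIJ : I ≤ J) : I = J :=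
      hIJ.eq_of_not_lt fun hlt =>
        (Ideal.IsIntegral.comap_lt_comap (R := A) hlt).ne (hIP.trans hJ.symm)
    exact (Ideal.subset_union.1 hle).imp (heq hQP) (heq ((hcomap Q).trans hQP))
  · rintro (rfl | rfl)
    · exact ⟨hQ, hQP⟩
    · exact ⟨hQ.comap τ, (hcomap Q).trans hQP⟩

section

variable {K : Type*} [Field K] [Algebra ℚ K]

theorem existsUnique_prime_over_of_sq_eq {p n : ℕ} (hp : p.Prime) (hp3 : p % 3 = 1)
    (hp4 : Even n → p % 4 = 3) {β : K} (hβ : β ^ 2 = 3 * (p : K) ^ n) (σ : K →ₐ[ℚ] K)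
    (hσ : σ β = -β) {F : IntermediateField ℚ K} (hF : F = IntermediateField.adjoin ℚ {β}) :
    ∃! P : Ideal (𝓞 F), P.IsPrime ∧ P.comap (algebraMap ℤ (𝓞 F)) = Ideal.span {(p : ℤ)} := by
  have : CharZero K := algebraRat.charZero K
  have hpZ := Nat.prime_iff_prime_int.1 hp
  have : (Ideal.span {(p : ℤ)}).IsPrime := (Ideal.span_singleton_prime hpZ.ne_zero).2 hpZ
  obtain ⟨P, -, hP, hPp⟩ := Ideal.exists_ideal_over_prime_of_isIntegral (S := 𝓞 F)
    (Ideal.span {(p : ℤ)}) ⊥ <| by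
    rw [← RingHom.ker_eq_comap_bot, (RingHom.injective_iff_ker_eq_bot _).1
      (FaithfulSMul.algebraMap_injective ℤ (𝓞 F))]
    exact bot_le
  have hle {P Q : Ideal (𝓞 F)} (hPp : P.comap (algebraMap ℤ (𝓞 F)) = Ideal.span {(p : ℤ)})
      (hQ : Q.IsPrime) (hQp : Q.comap (algebraMap ℤ (𝓞 F)) = Ideal.span {(p : ℤ)}) : P ≤ Q := by
    intro x hx
    obtain ⟨t, N, c, h, hd⟩ := exists_sq_sub_mul_add_eq_zero_of_isIntegral
      (x := algebraMap F K (algebraMap (𝓞 F) F x)) (d := 3 * (p : ℚ) ^ n)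
      (by simpa) σ hσ (hF ▸ (x : F).2)
      (map_isIntegral_int (algebraMap F K) x.2)
    have h' : x ^ 2 - t * x + N = 0 := by
      ext
      simpa using h
    have hN : (p : ℤ) ∣ N := by
      rw [← Int.mem_iff_dvd_of_comap_eq_span hPp]
      have : (N : 𝓞 F) = (t - x) * x := by linear_combination h'
      rw [this]
      exact P.mul_mem_left _ hx
    have ht := dvd_of_sq_sub_eq_three_mul_pow_mul_sq hp hp3 hp4 hd hN
    rw [← Int.mem_iff_dvd_of_comap_eq_span hQp] at hN ht
    refine hQ.mem_of_pow_mem 2 ?_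
    have : x ^ 2 = t * x - N := by linear_combination h'
    rw [this]
    exact Q.sub_mem (Q.mul_mem_right _ ht) hN
  exact ⟨P, ⟨hP, hPp⟩, fun Q ⟨hQ, hQp⟩ => le_antisymm (hle hQp hP hPp) (hle hPp hQ hQp)⟩

theorem mul_map_mem_of_adjoin_eq_top {y : K} (hgen : Algebra.adjoin ℚ {y} = ⊤)
    (F : IntermediateField ℚ K) (τ : K →ₐ[ℚ] K) (hτF : ∀ x ∈ F, τ x = x) (hadd : y + τ y ∈ F)
    (hmul : y * τ y ∈ F) (x : K) : x * τ x ∈ F := by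
  have hle : Algebra.adjoin ℚ {y} ≤ (Algebra.adjoin F {y}).restrictScalars ℚ :=
    Algebra.adjoin_le Algebra.subset_adjoin
  rw [hgen] at hle
  have hx : x ∈ Algebra.adjoin F {y} := hle Algebra.mem_top
  have hy : y ^ 2 = algebraMap F K ⟨_, hadd⟩ * y - algebraMap F K ⟨_, hmul⟩ := by
    change y ^ 2 = (y + τ y) * y - y * τ y
    ring
  obtain ⟨a, b, rfl⟩ := exists_add_mul_of_mem_adjoin_of_sq_eq hy hx
  have : (algebraMap F K a + algebraMap F K b * y) * τ (algebraMap F K a + algebraMap F K b * y) =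
      a ^ 2 + a * b * (y + τ y) + b ^ 2 * (y * τ y) := by
    simp only [IntermediateField.algebraMap_apply, map_add, map_mul, hτF _ a.2, hτF _ b.2]
    ring
  rw [this]
  exact add_mem (add_mem (pow_mem a.2 2) (mul_mem (mul_mem a.2 b.2) hadd))
    (mul_mem (pow_mem b.2 2) hmul)

theorem ncard_primes_over_adjoin_eq_two {p n : ℕ} (hp : p.Prime) (hp3 : p % 3 = 1) {π : K}
    (hπ : π ^ 4 - (p : K) ^ n * π ^ 2 + ((p : K) ^ n) ^ 2 = 0) (hgen : Algebra.adjoin ℚ {π} = ⊤)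
    (τ : K →ₐ[ℚ] K) (hτ : τ π = (p : K) ^ n * π⁻¹)
    {F : IntermediateField ℚ K} (hF : F = IntermediateField.adjoin ℚ {π + (p : K) ^ n * π⁻¹})
    (P : Ideal (𝓞 F)) [P.IsPrime] (hP : P.comap (algebraMap ℤ (𝓞 F)) = Ideal.span {(p : ℤ)}) :
    {Q : Ideal (𝓞 K) | Q.IsPrime ∧ Q.comap (algebraMap (𝓞 F) (𝓞 K)) = P}.ncard = 2 := by
  have : CharZero K := algebraRat.charZero K
  set q : K := (p : K) ^ n with hq
  have hq0 : q ≠ 0 := pow_ne_zero _ (by exact_mod_cast hp.ne_zero)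
  have hπ0 : π ≠ 0 := by
    rintro rfl
    simp [hq0] at hπ
  set β := π + q * π⁻¹ with hβ
  have hτq : τ q = q := by simp [hq]
  have hττ : ∀ x, τ (τ x) = x := by
    have : τ.comp τ = AlgHom.id ℚ K := AlgHom.ext_of_adjoin_eq_top hgen fun x hx => by
      rw [Set.mem_singleton_iff.1 hx]
      simp only [AlgHom.comp_apply, AlgHom.id_apply, hτ, map_mul, map_inv₀, hτq]
      field_simp
    exact fun x => DFunLike.congr_fun this x
  have hτF : ∀ x ∈ F, τ x = x := by
    have : F ≤ IntermediateField.mk (AlgHom.equalizer τ (AlgHom.id ℚ K))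
        (fun x hx => by simp_all) := by
      rw [hF, IntermediateField.adjoin_simple_le_iff]
      show τ β = β
      rw [hβ, map_add, hτ, ← hτ, hττ, add_comm]
    exact fun x hx => this hx
  have hqF : q ∈ F := by rw [hq]; exact pow_mem (natCast_mem F p) n
  have hβF : β ∈ F := hF ▸ IntermediateField.mem_adjoin_simple_self ℚ β
  have hβτ : π * (q * π⁻¹) = q := by field_simp
  have hnorm := mul_map_mem_of_adjoin_eq_top hgen F τ hτF (hτ ▸ hβF) (by rwa [hτ, hβτ])
  have hω : (π ^ 2 / q) ^ 2 - π ^ 2 / q + 1 = 0 := by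
    field_simp
    linear_combination hπ
  have hτω : τ (π ^ 2 / q) = 1 - π ^ 2 / q := by
    rw [map_div₀, map_pow, hτ, hτq]
    field_simp
    linear_combination hπ
  have hωint : IsIntegral ℤ (π ^ 2 / q) := by
    refine ⟨X ^ 2 - X + 1, by monicity!, ?_⟩
    simpa using hω
  obtain ⟨r, hr⟩ := exists_int_dvd_sq_sub_add_one hp hp3
  obtain ⟨ω, hωK⟩ : ∃ ω : 𝓞 K, (ω : K) = π ^ 2 / q := ⟨⟨_, hωint⟩, rfl⟩
  rw [← hωK] at hω hτω
  have hτω' : RingOfIntegers.mapRingHom (τ : K →+* K) ω = 1 - ω := by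
    ext
    change _ = algebraMap (𝓞 K) K (1 - ω)
    rw [map_sub, map_one]
    exact hτω
  have hω' : ω ^ 2 - ω + 1 = 0 := by
    ext
    simpa using hω
  refine ncard_primes_over_eq_two (RingOfIntegers.mapRingHom (τ : K →+* K)) (fun a => ?_)
    (fun b => ?_) P (u := ω - r) (m := ((r ^ 2 - r + 1 : ℤ) : 𝓞 F))
    (s := ((1 - 2 * r : ℤ) : 𝓞 F)) ?_ ((Int.mem_iff_dvd_of_comap_eq_span hP _).2 hr) ?_ ?_
  · ext
    exact hτF _ (a : F).2
  · refine ⟨⟨⟨_, hnorm b⟩, ?_⟩, ?_⟩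
    · refine (isIntegral_algebraMap_iff (algebraMap F K).injective).1 ?_
      exact b.2.mul (map_isIntegral_int (τ : K →+* K) b.2)
    · ext
      rfl
  · rw [map_sub, hτω', map_intCast, map_intCast]
    push_cast
    linear_combination -hω'
  · rw [map_sub, hτω', map_intCast, map_intCast]
    push_cast
    ring
  · rw [Int.mem_iff_dvd_of_comap_eq_span hP]
    intro h
    have h3 : (p : ℤ) ∣ (3 : ℕ) := by
      have := dvd_sub (hr.mul_left 4) (h.mul_left (1 - 2 * r))
      convert! this using 1
      push_cast
      ring
    have := (Nat.prime_dvd_prime_iff_eq hp Nat.prime_three).1 (Int.natCast_dvd_natCast.1 h3)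
    omega

theorem existsUnique_and_ncard_primes_over {p n : ℕ} (hp : p.Prime) (hp3 : p % 3 = 1)
    (hp4 : Even n → p % 4 = 3) {π : K}
    (hπ : π ^ 4 - (p : K) ^ n * π ^ 2 + ((p : K) ^ n) ^ 2 = 0) (hgen : Algebra.adjoin ℚ {π} = ⊤)
    (hlift : ∀ x : K, x ^ 4 - (p : K) ^ n * x ^ 2 + ((p : K) ^ n) ^ 2 = 0 →
      ∃ φ : K →ₐ[ℚ] K, φ π = x)
    {F : IntermediateField ℚ K} (hF : F = IntermediateField.adjoin ℚ {π + (p : K) ^ n * π⁻¹}) :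
    (∃! P : Ideal (𝓞 F), P.IsPrime ∧ P.comap (algebraMap ℤ (𝓞 F)) = Ideal.span {(p : ℤ)}) ∧
    ∀ P : Ideal (𝓞 F), P.IsPrime → P.comap (algebraMap ℤ (𝓞 F)) = Ideal.span {(p : ℤ)} →
      {Q : Ideal (𝓞 K) | Q.IsPrime ∧ Q.comap (algebraMap (𝓞 F) (𝓞 K)) = P}.ncard = 2 := by
  have : CharZero K := algebraRat.charZero K
  have hq0 : (p : K) ^ n ≠ 0 := pow_ne_zero _ (by exact_mod_cast hp.ne_zero)
  have hπ0 : π ≠ 0 := by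
    rintro rfl
    simp [hq0] at hπ
  obtain ⟨σ, hσ⟩ := hlift (-π) (by linear_combination hπ)
  obtain ⟨τ, hτ⟩ := hlift ((p : K) ^ n * π⁻¹) <| by
    trans ((p : K) ^ n) ^ 2 * π⁻¹ ^ 4 * (π ^ 4 - (p : K) ^ n * π ^ 2 + ((p : K) ^ n) ^ 2)
    · field_simp
      ring
    · rw [hπ, mul_zero]
  refine ⟨existsUnique_prime_over_of_sq_eq hp hp3 hp4 ?_ σ ?_ hF, fun P _ hPp =>
    ncard_primes_over_adjoin_eq_two hp hp3 hπ hgen τ hτ hF P hPp⟩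
  · field_simp
    linear_combination hπ
  · rw [map_add, map_mul, map_pow, map_natCast, map_inv₀, hσ, inv_neg]
    ring

end

theorem prime_over_p_splits (p n : ℕ) (hp : p.Prime) (hp3 : p % 3 = 1)
    (hp4 : Even n → p % 4 = 3) (hn : 1 ≤ n) (f : ℚ[X])
    (hf : f = X ^ 4 - C ((p : ℚ) ^ n) * X ^ 2 + C (((p : ℚ) ^ n) ^ 2))
    [Fact (Irreducible f)] :
    letI K := AdjoinRoot f
    letI Kplus := IntermediateField.adjoin ℚ
        {AdjoinRoot.root f + ((p : K) ^ n) * (AdjoinRoot.root f)⁻¹}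
    (∃! P : Ideal (𝓞 Kplus), P.IsPrime ∧
        P.comap (algebraMap ℤ (𝓞 Kplus)) = Ideal.span {(p : ℤ)}) ∧
    (∀ P : Ideal (𝓞 Kplus), P.IsPrime →
        P.comap (algebraMap ℤ (𝓞 Kplus)) = Ideal.span {(p : ℤ)} →
        {Q : Ideal (𝓞 K) | Q.IsPrime ∧ Q.comap (algebraMap (𝓞 Kplus) (𝓞 K)) = P}.ncard = 2) := by
  have heval (x : AdjoinRoot f) {g : ℚ[X]}
      (hg : g = X ^ 4 - C ((p : ℚ) ^ n) * X ^ 2 + C (((p : ℚ) ^ n) ^ 2)) :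
      eval₂ (algebraMap ℚ (AdjoinRoot f)) x g =
        x ^ 4 - (p : AdjoinRoot f) ^ n * x ^ 2 + ((p : AdjoinRoot f) ^ n) ^ 2 := by
    simp [hg]
  exact existsUnique_and_ncard_primes_over hp hp3 hp4
    ((heval _ hf).symm.trans (AdjoinRoot.eval₂_root f)) AdjoinRoot.adjoinRoot_eq_top
    (fun x hx => ⟨AdjoinRoot.liftAlgHom f (Algebra.ofId ℚ _) x ((heval x hf).trans hx),
      AdjoinRoot.liftAlgHom_root ..⟩) rfl
end

section
/- Let n ≥ 1 be odd, let q = 2^n, and let t be the positive integer with t² = 2q. Then the polynomial f = X⁴ + tX³ + qX² + tqX + q² is irreducible over ℚ; moreover, letting K = ℚ[X]/(f) with π the image of X and K⁺ = ℚ(π + q/π), there is a prime ideal 𝔭 of the ring of integers of K⁺ lying over the rational prime 2 such that 𝔭 is inert in K/K⁺ (its extension to the ring of integers of K is prime) and such that the element π − q/π lies in the extension of 𝔭 to the ring of integers of K. The same holds with t replaced by −t. -/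
open Polynomial NumberField

/-- A number field of degree four that contains `√3` and `√-1` is `ℚ(ζ₁₂)`, in which `1 + √3` is a
prime element above `2`. -/
theorem NumberField.isPrime_span_one_add_sqrt_three {K : Type*} [Field K] [NumberField K]
    (hdim : Module.finrank ℚ K = 4) {r i : 𝓞 K} (hr : r ^ 2 = 3) (hi : i ^ 2 = -1) :
    (Ideal.span {1 + r}).IsPrime := by
  have hunit : IsUnit (2 + r) :=
    IsUnit.of_mul_eq_one (2 - r) (by linear_combination -hr)
  have hsq : Ideal.span {1 + r} ^ 2 = Ideal.span {(2 : 𝓞 K)} := by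
    rw [Ideal.span_singleton_pow, show (1 + r) ^ 2 = 2 * (2 + r) by linear_combination hr]
    exact Ideal.span_singleton_mul_right_unit hunit 2
  have hnorm_two : Ideal.absNorm (Ideal.span {(2 : 𝓞 K)}) = 4 ^ 2 := by
    have h := Algebra.norm_algebraMap_of_basis (RingOfIntegers.basis K) (2 : ℤ)
    rw [← Module.finrank_eq_card_basis (RingOfIntegers.basis K), RingOfIntegers.rank, hdim,
      map_ofNat] at h
    rw [Ideal.absNorm_span_singleton, h]
    rfl
  have hnorm : Ideal.absNorm (Ideal.span {1 + r}) = 4 := by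
    rw [← hsq, map_pow] at hnorm_two
    exact Nat.pow_left_injective (n := 2) (by norm_num) hnorm_two
  obtain ⟨ω, hω⟩ : ∃ ω : 𝓞 K, ω ^ 2 + ω + 1 = 0 := by
    have hrK : (r : K) ^ 2 = 3 := by
      rw [← map_pow, hr]
      exact map_ofNat (algebraMap (𝓞 K) K) 3
    have hiK : (i : K) ^ 2 = -1 := by
      rw [← map_pow, hi, map_neg, map_one]
    have hωK : ((-1 + r * i) / 2 : K) ^ 2 + (-1 + r * i) / 2 + 1 = 0 := by
      linear_combination (1 / 4 : K) * (i : K) ^ 2 * hrK + (3 / 4 : K) * hiK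
    have hint : IsIntegral ℤ ((-1 + r * i) / 2 : K) :=
      ⟨X ^ 2 + X + 1, by monicity!, by simpa using hωK⟩
    exact ⟨⟨_, hint⟩, RingOfIntegers.ext hωK⟩
  have hne : Ideal.span {1 + r} ≠ ⊤ := fun h => by
    rw [h, Ideal.absNorm_top] at hnorm
    omega
  obtain ⟨M, hM, hle⟩ := Ideal.exists_le_maximal _ hne
  obtain ⟨J, hJ⟩ := Ideal.dvd_iff_le.mpr hle
  have hmul : Ideal.absNorm M * Ideal.absNorm J = 4 := by
    rw [← map_mul, ← hJ, hnorm]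
  have htwo : (2 : 𝓞 K) ∈ M :=
    hle (Ideal.pow_le_self two_ne_zero (hsq ▸ Ideal.mem_span_singleton_self _))
  have hM_ne_one : Ideal.absNorm M ≠ 1 := fun h => hM.ne_top (Ideal.absNorm_eq_one_iff.mp h)
  have hM_ne_two : Ideal.absNorm M ≠ 2 := fun h => by
    have hcard : Nat.card (𝓞 K ⧸ M) = 2 := h
    have : Nontrivial (𝓞 K ⧸ M) := Ideal.Quotient.nontrivial_iff.mpr hM.ne_top
    have hz : ∀ z : 𝓞 K ⧸ M, z = 0 ∨ z = 1 := fun z => by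
      obtain ⟨x, y, hxy, huniv⟩ := Nat.card_eq_two_iff.mp hcard
      have h0 : (0 : 𝓞 K ⧸ M) ∈ ({x, y} : Set _) := huniv ▸ Set.mem_univ _
      have h1 : (1 : 𝓞 K ⧸ M) ∈ ({x, y} : Set _) := huniv ▸ Set.mem_univ _
      have h2 : z ∈ ({x, y} : Set _) := huniv ▸ Set.mem_univ _
      have h3 : (0 : 𝓞 K ⧸ M) ≠ 1 := zero_ne_one
      simp only [Set.mem_insert_iff, Set.mem_singleton_iff] at h0 h1 h2
      grind
    have hω' := congrArg (Ideal.Quotient.mk M) hω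
    have htwo' : (2 : 𝓞 K ⧸ M) = 0 := 
      Ideal.Quotient.eq_zero_iff_mem.mpr htwo
    simp only [map_add, map_pow, map_one, map_zero] at hω'
    rcases hz (Ideal.Quotient.mk M ω) with h | h <;> rw [h] at hω'
    · simp at hω'
    · exact one_ne_zero (α := 𝓞 K ⧸ M) (by linear_combination hω' - htwo')
  have hJ_one : Ideal.absNorm J = 1 := by
    have hdvd : Ideal.absNorm M ≤ 4 := Nat.le_of_dvd (by norm_num) ⟨_, hmul.symm⟩
    interval_cases hc : Ideal.absNorm M <;> omega
  rw [hJ, Ideal.absNorm_eq_one_iff.mp hJ_one, Ideal.mul_top]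
  exact hM.isPrime

/-- If a subfield of a quartic number field `K = ℚ(√3, √-1)` contains `√3`, it has a prime above `2`
whose extension to `𝓞 K` is prime and contains every integer multiple of `(1 + √3) * √-1`. -/
theorem NumberField.exists_inert_prime_over_two {K : Type*} [Field K] [NumberField K]
    (hdim : Module.finrank ℚ K = 4) (L : IntermediateField ℚ K) {r i : K} (hrL : r ∈ L)
    (hr : r ^ 2 = 3) (hi : i ^ 2 = -1) {c : ℤ} {y : K} (hy : y = c * (1 + r) * i) :
    ∃ P : Ideal (𝓞 L), P.IsPrime ∧
      P.comap (algebraMap ℤ (𝓞 L)) = Ideal.span {(2 : ℤ)} ∧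
      (P.map (algebraMap (𝓞 L) (𝓞 K))).IsPrime ∧
      ∃ x : 𝓞 K, (x : K) = y ∧ x ∈ P.map (algebraMap (𝓞 L) (𝓞 K)) := by
  have hint : IsIntegral ℤ (⟨r, hrL⟩ : L) :=
    ⟨X ^ 2 - 3, by monicity!, by
      have h : (⟨r, hrL⟩ : L) ^ 2 = 3 := Subtype.ext hr
      simp [h]⟩
  have hinti : IsIntegral ℤ i := ⟨X ^ 2 + 1, by monicity!, by simp [hi]⟩
  let r₀ : 𝓞 L := ⟨⟨r, hrL⟩, hint⟩
  let r₁ : 𝓞 K := algebraMap (𝓞 L) (𝓞 K) r₀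
  let i₁ : 𝓞 K := ⟨i, hinti⟩
  have hr₁K : (r₁ : K) = r := rfl
  have hi₁K : (i₁ : K) = i := rfl
  have hr₁ : r₁ ^ 2 = 3 := RingOfIntegers.ext hr
  have hi₁ : i₁ ^ 2 = -1 := RingOfIntegers.ext hi
  have hprime := isPrime_span_one_add_sqrt_three hdim hr₁ hi₁
  have hmem : 1 + r₀ ∈ (Ideal.span {1 + r₁}).comap (algebraMap (𝓞 L) (𝓞 K)) := by
    rw [Ideal.mem_comap, map_add, map_one]
    exact Ideal.mem_span_singleton_self _
  have hmap : ((Ideal.span {1 + r₁}).comap (algebraMap (𝓞 L) (𝓞 K))).map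
      (algebraMap (𝓞 L) (𝓞 K)) = Ideal.span {1 + r₁} := by
    refine le_antisymm Ideal.map_comap_le ?_
    rw [Ideal.span_singleton_le_iff_mem]
    simpa [r₁] using Ideal.mem_map_of_mem (algebraMap (𝓞 L) (𝓞 K)) hmem
  refine ⟨(Ideal.span {1 + r₁}).comap (algebraMap (𝓞 L) (𝓞 K)), hprime.comap _, ?_, ?_, ?_⟩
  · rw [Ideal.comap_comap]
    have hmax : (Ideal.span {(2 : ℤ)}).IsMaximal :=
      PrincipalIdealRing.isMaximal_of_irreducible Int.prime_two.irreducible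
    refine (hmax.eq_of_le (hprime.comap _).ne_top ?_).symm
    rw [Ideal.span_singleton_le_iff_mem, Ideal.mem_comap, Ideal.mem_span_singleton, map_ofNat]
    exact ⟨r₁ - 1, by linear_combination -hr₁⟩
  · rwa [hmap]
  · refine ⟨c * (1 + r₁) * i₁, ?_, ?_⟩
    · simp [hy, hr₁K, hi₁K]
    · rw [hmap, Ideal.mem_span_singleton]
      exact ⟨c * i₁, by ring⟩

theorem irreducible_quartic_int :
    Irreducible (X ^ 4 + 2 * X ^ 3 + 2 * X ^ 2 + 4 * X + 4 : ℤ[X]) := by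
  have hm : (X ^ 4 + 2 * X ^ 3 + 2 * X ^ 2 + 4 * X + 4 : ℤ[X]).Monic := by monicity!
  have hd : (X ^ 4 + 2 * X ^ 3 + 2 * X ^ 2 + 4 * X + 4 : ℤ[X]).natDegree = 4 := by compute_degree!
  refine hm.irreducible_iff_natDegree'.mpr ⟨fun h => by simp [h] at hd, ?_⟩
  intro f g hf hg hfg hmem
  rw [hd, Finset.mem_Ioc] at hmem
  have hfd : f.natDegree + g.natDegree = 4 := by rw [← hf.natDegree_mul hg, hfg, hd]
  obtain h1 | h2 : g.natDegree = 1 ∨ g.natDegree = 2 := by omega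
  · have hg_eq : g = X + C (g.coeff 0) := by
      conv_lhs => rw [hg.as_sum, h1]
      simp
    have heval := congrArg (eval (-g.coeff 0)) hfg
    rw [eval_mul, hg_eq] at heval
    simp at heval
    set x := g.coeff 0
    have hsum : (x ^ 2 - x) ^ 2 + (2 - x) ^ 2 = 0 := by linear_combination -heval
    have hx : x = 2 := by nlinarith [sq_nonneg (x ^ 2 - x), sq_nonneg (2 - x)]
    norm_num [hx] at hsum
  · have hquad : ∀ p : ℤ[X], p.Monic → p.natDegree = 2 →
        p = X ^ 2 + C (p.coeff 1) * X + C (p.coeff 0) := fun p hp hp2 => by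
      conv_lhs => rw [hp.as_sum, hp2]
      simp [Finset.sum_range_succ]
      ring
    rw [hquad f hf (by omega), hquad g hg h2] at hfg
    generalize f.coeff 0 = b at hfg
    generalize f.coeff 1 = a at hfg
    generalize g.coeff 0 = e at hfg
    generalize g.coeff 1 = d at hfg
    have hexpand : (X ^ 2 + C a * X + C b) * (X ^ 2 + C d * X + C e) =
        X ^ 4 + C (a + d) * X ^ 3 + C (b + e + a * d) * X ^ 2 + C (a * e + b * d) * X
          + C (b * e) := by
      simp only [map_add, map_mul]
      ring
    have htarget : (X ^ 4 + 2 * X ^ 3 + 2 * X ^ 2 + 4 * X + 4 : ℤ[X]) =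
        X ^ 4 + C 2 * X ^ 3 + C 2 * X ^ 2 + C 4 * X + C 4 := by
      simp
    rw [hexpand, htarget] at hfg
    have h0 := congrArg (coeff · 0) hfg
    have h1 := congrArg (coeff · 1) hfg
    have h2 := congrArg (coeff · 2) hfg
    have h3 := congrArg (coeff · 3) hfg
    norm_num [coeff_X, coeff_C, coeff_X_pow, coeff_C_mul, -eq_intCast, -map_add, -map_mul, -map_sub] at h0 h1 h2 h3
    have hb : b ∣ 4 := ⟨e, h0.symm⟩
    have hble : b ≤ 4 := Int.le_of_dvd (by norm_num) hb
    have hbge : -4 ≤ b := by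
      have := Int.le_of_dvd (by norm_num) (neg_dvd.mpr hb)
      linarith
    obtain rfl : d = 2 - a := by linarith
    have hsq : (a - 1) ^ 2 = b + e - 1 := by linear_combination -h2
    have hthree : ¬ (a - 1) ^ 2 = 3 := fun h => by
      have h4 : a - 1 < 2 := by nlinarith
      have h5 : -2 < a - 1 := by nlinarith
      generalize a - 1 = z at *
      interval_cases z <;> omega
    have hnonneg : 0 ≤ b + e - 1 := hsq ▸ sq_nonneg _
    have hcases : b = 1 ∧ e = 4 ∨ b = 2 ∧ e = 2 ∨ b = 4 ∧ e = 1 := by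
      clear hfg hexpand h1 h2 hsq
      interval_cases b <;> omega
    obtain ⟨rfl, rfl⟩ | ⟨rfl, rfl⟩ | ⟨rfl, rfl⟩ := hcases
    · omega
    · exact hthree (by linarith)
    · omega

/-- The roots of this quartic are `c` times those of `irreducible_quartic_int`. -/
theorem irreducible_quartic_rat {c : ℚ} (hc : c ≠ 0) :
    Irreducible (X ^ 4 + C (2 * c) * X ^ 3 + C (2 * c ^ 2) * X ^ 2
      + C (2 * c * (2 * c ^ 2)) * X + C ((2 * c ^ 2) ^ 2) : ℚ[X]) := by
  have hm : (X ^ 4 + 2 * X ^ 3 + 2 * X ^ 2 + 4 * X + 4 : ℤ[X]).Monic := by monicity!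
  have hQ : Irreducible (X ^ 4 + 2 * X ^ 3 + 2 * X ^ 2 + 4 * X + 4 : ℚ[X]) := by
    simpa using (hm.irreducible_iff_irreducible_map_fraction_map (K := ℚ)).mp
      irreducible_quartic_int
  let _ : Invertible c := invertibleOfNonzero hc
  rw [← MulEquiv.irreducible_iff (algEquivCMulXAddC c 0)]
  have hu : IsUnit (C (c ^ 4) : ℚ[X]) := isUnit_C.mpr (pow_ne_zero 4 hc).isUnit
  convert (irreducible_isUnit_mul hu).mpr hQ using 1
  rw [← C_ofNat 2, ← C_ofNat 4]
  simp [-map_pow, -map_mul]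
  simp only [map_pow, map_mul, map_ofNat, aeval_C, aeval_X, algebraMap_eq]
  ring



theorem A_sqrt2q_inert_prime_divides (n : ℕ) (hn : 1 ≤ n) (hodd : Odd n)
    (t : ℤ) (ht : 0 < t) (ht2 : t ^ 2 = 2 * 2 ^ n) :
    ∀ s : ℤ, (s = t ∨ s = -t) →
      ∃ hirr : Irreducible (X ^ 4 + C (s : ℚ) * X ^ 3 + C ((2 : ℚ) ^ n) * X ^ 2
          + C ((s : ℚ) * (2 : ℚ) ^ n) * X + C (((2 : ℚ) ^ n) ^ 2) : ℚ[X]),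
        letI f : ℚ[X] := X ^ 4 + C (s : ℚ) * X ^ 3 + C ((2 : ℚ) ^ n) * X ^ 2
          + C ((s : ℚ) * (2 : ℚ) ^ n) * X + C (((2 : ℚ) ^ n) ^ 2)
        haveI : Fact (Irreducible f) := ⟨hirr⟩
        letI K := AdjoinRoot f
        letI π := AdjoinRoot.root f
        letI Kplus := IntermediateField.adjoin ℚ {π + ((2 : K) ^ n) * π⁻¹}
        ∃ P : Ideal (𝓞 Kplus), P.IsPrime ∧
          P.comap (algebraMap ℤ (𝓞 Kplus)) = Ideal.span {(2 : ℤ)} ∧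
          (P.map (algebraMap (𝓞 Kplus) (𝓞 K))).IsPrime ∧
          ∃ x : 𝓞 K, (x : K) = π - ((2 : K) ^ n) * π⁻¹ ∧
            x ∈ P.map (algebraMap (𝓞 Kplus) (𝓞 K)) := by
  intro s hs
  have hs2 : s ^ 2 = 2 * 2 ^ n := by rcases hs with rfl | rfl <;> simpa using ht2
  have hs0 : s ≠ 0 := by rintro rfl; simp at hs2
  obtain ⟨c, hsc⟩ : (2 : ℤ) ∣ s :=
    Int.prime_two.dvd_of_dvd_pow (n := 2) (hs2 ▸ Dvd.intro _ rfl)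
  have hc0 : c ≠ 0 := by rintro rfl; simp [hsc] at hs0
  have hq : (2 : ℤ) ^ n = 2 * c ^ 2 := by
    rw [hsc] at hs2
    linarith
  have hsQ : (s : ℚ) = 2 * c := by exact_mod_cast hsc
  have hqQ : (2 : ℚ) ^ n = 2 * (c : ℚ) ^ 2 := by exact_mod_cast hq
  have hirr : Irreducible (X ^ 4 + C (s : ℚ) * X ^ 3 + C ((2 : ℚ) ^ n) * X ^ 2
      + C ((s : ℚ) * (2 : ℚ) ^ n) * X + C (((2 : ℚ) ^ n) ^ 2) : ℚ[X]) := by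
    rw [hsQ, hqQ]
    exact irreducible_quartic_rat (Int.cast_ne_zero.mpr hc0)
  refine ⟨hirr, ?_⟩
  have hdeg : (X ^ 4 + C (s : ℚ) * X ^ 3 + C ((2 : ℚ) ^ n) * X ^ 2
      + C ((s : ℚ) * (2 : ℚ) ^ n) * X + C (((2 : ℚ) ^ n) ^ 2) : ℚ[X]).natDegree = 4 := by
    compute_degree!
  generalize hf : (X ^ 4 + C (s : ℚ) * X ^ 3 + C ((2 : ℚ) ^ n) * X ^ 2
      + C ((s : ℚ) * (2 : ℚ) ^ n) * X + C (((2 : ℚ) ^ n) ^ 2) : ℚ[X]) = f at hirr hdeg ⊢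
  have : Fact (Irreducible f) := ⟨hirr⟩
  have hKdim : Module.finrank ℚ (AdjoinRoot f) = 4 := by
    rw [(AdjoinRoot.powerBasis hirr.ne_zero).finrank, AdjoinRoot.powerBasis_dim, hdeg]
  have : CharZero (AdjoinRoot f) := algebraRat.charZero _
  have : FiniteDimensional ℚ (AdjoinRoot f) :=
    Module.finite_of_finrank_pos (by rw [hKdim]; norm_num)
  have : NumberField (AdjoinRoot f) := ⟨⟩
  have hqK : (2 : AdjoinRoot f) ^ n = 2 * (c : AdjoinRoot f) ^ 2 := by exact_mod_cast hq
  have hcK : (c : AdjoinRoot f) ≠ 0 := Int.cast_ne_zero.mpr hc0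
  have hroot : eval₂ (AdjoinRoot.of f) (AdjoinRoot.root f) (X ^ 4 + C (s : ℚ) * X ^ 3
      + C ((2 : ℚ) ^ n) * X ^ 2 + C ((s : ℚ) * (2 : ℚ) ^ n) * X + C (((2 : ℚ) ^ n) ^ 2)) = 0 := by
    rw [hf]
    exact AdjoinRoot.eval₂_root f
  simp only [eval₂_add, eval₂_mul, eval₂_pow, eval₂_X, eval₂_C] at hroot
  simp only [hsQ, hqQ, map_mul, map_pow, map_ofNat, map_intCast] at hroot
  generalize AdjoinRoot.root f = π at hroot ⊢
  have hπ0 : π ≠ 0 := by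
    rintro rfl
    simp [hcK] at hroot
  set β := π + (2 : AdjoinRoot f) ^ n * π⁻¹ with hβ
  set δ := π - (2 : AdjoinRoot f) ^ n * π⁻¹ with hδ
  have hβ2 : β ^ 2 + 2 * c * β - 2 * c ^ 2 = 0 := by
    rw [hβ, hqK]
    field_simp
    linear_combination hroot
  have hδ2 : δ ^ 2 = β ^ 2 - 8 * c ^ 2 := by
    rw [hβ, hδ, hqK]
    field_simp
    ring
  have hr : (1 + β / c) ^ 2 = 3 := by
    field_simp
    linear_combination hβ2
  have hr0 : 1 + (1 + β / c) ≠ 0 := fun h => by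
    rw [show 1 + β / c = -1 by linear_combination h] at hr
    norm_num at hr
  refine NumberField.exists_inert_prime_over_two (r := 1 + β / c)
    (i := δ / (c * (1 + (1 + β / c)))) (c := c) hKdim _ ?_ hr ?_ ?_
  · exact add_mem (one_mem _) (div_mem (IntermediateField.mem_adjoin_simple_self ℚ β)
      (intCast_mem _ c))
  · rw [div_pow, div_eq_iff (pow_ne_zero 2 (mul_ne_zero hcK hr0)), hδ2]
    field_simp
    linear_combination 2 * hβ2
  · exact (mul_div_cancel₀ δ (mul_ne_zero hcK hr0)).symm
end
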